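/- arXiv:2503.02975 — 4 statements merged into one kernel-verified Lean document; each statement's English description precedes it below -/
import Mathlib

section
/- Let p be an IMP^W program, s a state, w : ℕ and n : ℕ. If every constant N m occurring in p satisfies m < 2^w, if s r < 2^w for every register r, and if (p, s) ⇒ⁿ s', then s' r < 2^(w+n) for every register r. -/
set_option autoImplicit false

/-- An IMP state maps register names to natural number values. -/
abbrev State := String → ℕ

/-- Atoms: constants and registers. -/
inductive Atom : Type where
  | N : ℕ → Atom
  | V : String → Atom

/-- Arithmetic expressions: atoms, addition, truncated subtraction of atoms. -/
inductive Aexp : Type where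
  | atom : Atom → Aexp
  | add : Atom → Atom → Aexp
  | sub : Atom → Atom → Aexp

/-- Evaluation of atoms. -/
def avalAtom : Atom → State → ℕ
  | .N n, _ => n
  | .V r, s => s r

/-- Evaluation of arithmetic expressions. -/
def aval : Aexp → State → ℕ
  | .atom A, s => avalAtom A s
  | .add A₁ A₂, s => avalAtom A₁ s + avalAtom A₂ s
  | .sub A₁ A₂, s => avalAtom A₁ s - avalAtom A₂ s

/-- Pointwise state update s[r ↦ v]. -/
def stUpd (s : State) (r : String) (v : ℕ) : State :=
  fun r' => if r = r' then v else s r'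

/-- IMP^W commands. -/
inductive ComW : Type where
  | assign : String → Aexp → ComW
  | seq : ComW → ComW → ComW
  | ifc : String → ComW → ComW → ComW
  | whl : String → ComW → ComW

/-- Big-step semantics of IMP^W with step counts: (p, s) ⇒ⁿ s'. -/
inductive BigStepW : ComW → State → ℕ → State → Prop where
  | assign (r : String) (a : Aexp) (s : State) :
      BigStepW (.assign r a) s 1 (stUpd s r (aval a s))
  | seq {p₁ p₂ : ComW} {s s' s'' : State} {n₁ n₂ : ℕ} :
      BigStepW p₁ s n₁ s' → BigStepW p₂ s' n₂ s'' →
      BigStepW (.seq p₁ p₂) s (n₁ + n₂ + 1) s''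
  | ifTrue {r : String} {p₁ p₂ : ComW} {s s' : State} {n : ℕ} :
      s r ≠ 0 → BigStepW p₁ s n s' → BigStepW (.ifc r p₁ p₂) s (n + 1) s'
  | ifFalse {r : String} {p₁ p₂ : ComW} {s s' : State} {n : ℕ} :
      s r = 0 → BigStepW p₂ s n s' → BigStepW (.ifc r p₁ p₂) s (n + 1) s'
  | whileFalse {r : String} {p : ComW} {s : State} :
      s r = 0 → BigStepW (.whl r p) s 1 s
  | whileTrue {r : String} {p : ComW} {s s' s'' : State} {n₁ n₂ : ℕ} :
      s r ≠ 0 → BigStepW p s n₁ s' → BigStepW (.whl r p) s' n₂ s'' →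
      BigStepW (.whl r p) s (n₁ + n₂ + 2) s''

/-- Constants occurring in an atom. -/
def constsAtom : Atom → List ℕ
  | .N n => [n]
  | .V _ => []

/-- Constants occurring in an arithmetic expression. -/
def constsAexp : Aexp → List ℕ
  | .atom A => constsAtom A
  | .add A₁ A₂ => constsAtom A₁ ++ constsAtom A₂
  | .sub A₁ A₂ => constsAtom A₁ ++ constsAtom A₂

/-- Constants occurring in an IMP^W program. -/
def constsW : ComW → List ℕ
  | .assign _ a => constsAexp a
  | .seq p₁ p₂ => constsW p₁ ++ constsW p₂
  | .ifc _ p₁ p₂ => constsW p₁ ++ constsW p₂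
  | .whl _ p => constsW p

/-- Registers of an atom. -/
def varsAtom : Atom → Finset String
  | .N _ => ∅
  | .V r => {r}

/-- Registers of an arithmetic expression. -/
def varsAexp : Aexp → Finset String
  | .atom A => varsAtom A
  | .add A₁ A₂ => varsAtom A₁ ∪ varsAtom A₂
  | .sub A₁ A₂ => varsAtom A₁ ∪ varsAtom A₂

/-- Registers occurring in an IMP^W program. -/
def varsW : ComW → Finset String
  | .assign r a => {r} ∪ varsAexp a
  | .seq p₁ p₂ => varsW p₁ ∪ varsW p₂
  | .ifc r p₁ p₂ => {r} ∪ varsW p₁ ∪ varsW p₂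
  | .whl r p => {r} ∪ varsW p

/-- IMP^TC commands: assignment, sequencing, if, calls of IMP^W programs, tail recursion. -/
inductive ComTC : Type where
  | assign : String → Aexp → ComTC
  | seq : ComTC → ComTC → ComTC
  | ifc : String → ComTC → ComTC → ComTC
  | call : ComW → String → ComTC
  | recurse : ComTC

/-- Registers occurring in an IMP^TC program (including called programs and return registers). -/
def varsTC : ComTC → Finset String
  | .assign r a => {r} ∪ varsAexp a
  | .seq p₁ p₂ => varsTC p₁ ∪ varsTC p₂
  | .ifc r p₁ p₂ => {r} ∪ varsTC p₁ ∪ varsTC p₂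
  | .call pc r => varsW pc ∪ {r}
  | .recurse => ∅

/-- Constants occurring in an IMP^TC program, including those of called IMP^W programs. -/
def constsTC : ComTC → List ℕ
  | .assign _ a => constsAexp a
  | .seq p₁ p₂ => constsTC p₁ ++ constsTC p₂
  | .ifc _ p₁ p₂ => constsTC p₁ ++ constsTC p₂
  | .call pc _ => constsW pc
  | .recurse => []

/-- Big-step semantics of IMP^TC relative to a context program `tp`,
with recursion cost constant `cR`: tp ⊢ (p, s) ⇒ⁿ s'. -/
inductive BigStepTC (cR : ℕ) (tp : ComTC) : ComTC → State → ℕ → State → Prop where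
  | assign (r : String) (a : Aexp) (s : State) :
      BigStepTC cR tp (.assign r a) s 1 (stUpd s r (aval a s))
  | seq {p₁ p₂ : ComTC} {s s' s'' : State} {n₁ n₂ : ℕ} :
      BigStepTC cR tp p₁ s n₁ s' → BigStepTC cR tp p₂ s' n₂ s'' →
      BigStepTC cR tp (.seq p₁ p₂) s (n₁ + n₂ + 1) s''
  | ifTrue {r : String} {p₁ p₂ : ComTC} {s s' : State} {n : ℕ} :
      s r ≠ 0 → BigStepTC cR tp p₁ s n s' → BigStepTC cR tp (.ifc r p₁ p₂) s (n + 1) s'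
  | ifFalse {r : String} {p₁ p₂ : ComTC} {s s' : State} {n : ℕ} :
      s r = 0 → BigStepTC cR tp p₂ s n s' → BigStepTC cR tp (.ifc r p₁ p₂) s (n + 1) s'
  | call {pc : ComW} {r : String} {s s₁ : State} {n : ℕ} :
      BigStepW pc s n s₁ → BigStepTC cR tp (.call pc r) s n (stUpd s r (s₁ r))
  | recurse {s s' : State} {n : ℕ} :
      BigStepTC cR tp tp s n s' → BigStepTC cR tp .recurse s (n + cR) s'

/-- Flagged big-step semantics of IMP^TC: runs a program but stops with flag 1
at tail-recursive calls; otherwise terminates with flag 0. -/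
inductive BigStepF : ComTC → State → ℕ → State → ℕ → Prop where
  | assign (r : String) (a : Aexp) (s : State) :
      BigStepF (.assign r a) s 1 (stUpd s r (aval a s)) 0
  | call {pc : ComW} {r : String} {s s₁ : State} {n : ℕ} :
      BigStepW pc s n s₁ → BigStepF (.call pc r) s n (stUpd s r (s₁ r)) 0
  | recurse (s : State) : BigStepF .recurse s 1 s 1
  | seq {p₁ p₂ : ComTC} {s s' s'' : State} {n₁ n₂ b : ℕ} :
      BigStepF p₁ s n₁ s' 0 → BigStepF p₂ s' n₂ s'' b →
      BigStepF (.seq p₁ p₂) s (n₁ + n₂ + 1) s'' b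
  | ifTrue {r : String} {p₁ p₂ : ComTC} {s s' : State} {n b : ℕ} :
      s r ≠ 0 → BigStepF p₁ s n s' b → BigStepF (.ifc r p₁ p₂) s (n + 1) s' b
  | ifFalse {r : String} {p₁ p₂ : ComTC} {s s' : State} {n b : ℕ} :
      s r = 0 → BigStepF p₂ s n s' b → BigStepF (.ifc r p₁ p₂) s (n + 1) s' b

/-- IMP^WC commands: IMP^W plus calls of IMP^W programs. -/
inductive ComWC : Type where
  | assign : String → Aexp → ComWC
  | seq : ComWC → ComWC → ComWC
  | ifc : String → ComWC → ComWC → ComWC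
  | whl : String → ComWC → ComWC
  | call : ComW → String → ComWC

/-- Big-step semantics of IMP^WC with step counts. -/
inductive BigStepWC : ComWC → State → ℕ → State → Prop where
  | assign (r : String) (a : Aexp) (s : State) :
      BigStepWC (.assign r a) s 1 (stUpd s r (aval a s))
  | seq {p₁ p₂ : ComWC} {s s' s'' : State} {n₁ n₂ : ℕ} :
      BigStepWC p₁ s n₁ s' → BigStepWC p₂ s' n₂ s'' →
      BigStepWC (.seq p₁ p₂) s (n₁ + n₂ + 1) s''
  | ifTrue {r : String} {p₁ p₂ : ComWC} {s s' : State} {n : ℕ} :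
      s r ≠ 0 → BigStepWC p₁ s n s' → BigStepWC (.ifc r p₁ p₂) s (n + 1) s'
  | ifFalse {r : String} {p₁ p₂ : ComWC} {s s' : State} {n : ℕ} :
      s r = 0 → BigStepWC p₂ s n s' → BigStepWC (.ifc r p₁ p₂) s (n + 1) s'
  | whileFalse {r : String} {p : ComWC} {s : State} :
      s r = 0 → BigStepWC (.whl r p) s 1 s
  | whileTrue {r : String} {p : ComWC} {s s' s'' : State} {n₁ n₂ : ℕ} :
      s r ≠ 0 → BigStepWC p s n₁ s' → BigStepWC (.whl r p) s' n₂ s'' →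
      BigStepWC (.whl r p) s (n₁ + n₂ + 2) s''
  | call {pc : ComW} {r : String} {s s₁ : State} {n : ℕ} :
      BigStepW pc s n s₁ → BigStepWC (.call pc r) s n (stUpd s r (s₁ r))

/-- Registers occurring in an IMP^WC program (including called programs and return registers). -/
def varsWC : ComWC → Finset String
  | .assign r a => {r} ∪ varsAexp a
  | .seq p₁ p₂ => varsWC p₁ ∪ varsWC p₂
  | .ifc r p₁ p₂ => {r} ∪ varsWC p₁ ∪ varsWC p₂
  | .whl r p => {r} ∪ varsWC p
  | .call pc r => varsW pc ∪ {r}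

/-- Substitute every occurrence of RECURSE in an IMP^TC program by the IMP^WC command `q`. -/
def substRec (q : ComWC) : ComTC → ComWC
  | .assign r a => .assign r a
  | .seq p₁ p₂ => .seq (substRec q p₁) (substRec q p₂)
  | .ifc r p₁ p₂ => .ifc r (substRec q p₁) (substRec q p₂)
  | .call pc r => .call pc r
  | .recurse => q

/-- (p, s) ⇒ⁿ_R s' for IMP^W. -/
def BigStepWPart (p : ComW) (s : State) (n : ℕ) (R : Finset String) (s' : State) : Prop :=
  ∃ (n' : ℕ) (s'' : State), n' ≤ n ∧ BigStepW p s n' s'' ∧ ∀ r ∈ R, s'' r = s' r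

/-- (p, s) ⇒ⁿ_R s' for IMP^WC. -/
def BigStepWCPart (p : ComWC) (s : State) (n : ℕ) (R : Finset String) (s' : State) : Prop :=
  ∃ (n' : ℕ) (s'' : State), n' ≤ n ∧ BigStepWC p s n' s'' ∧ ∀ r ∈ R, s'' r = s' r

/-- tp ⊢ (p, s) ⇒ⁿ_R s' for IMP^TC. -/
def BigStepTCPart (cR : ℕ) (tp p : ComTC) (s : State) (n : ℕ) (R : Finset String)
    (s' : State) : Prop :=
  ∃ (n' : ℕ) (s'' : State), n' ≤ n ∧ BigStepTC cR tp p s n' s'' ∧ ∀ r ∈ R, s'' r = s' r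

/-- Rename the registers of an atom along `m`. -/
def renameAtom (m : String → String) : Atom → Atom
  | .N n => .N n
  | .V r => .V (m r)

/-- Rename the registers of an arithmetic expression along `m`. -/
def renameAexp (m : String → String) : Aexp → Aexp
  | .atom A => .atom (renameAtom m A)
  | .add A₁ A₂ => .add (renameAtom m A₁) (renameAtom m A₂)
  | .sub A₁ A₂ => .sub (renameAtom m A₁) (renameAtom m A₂)

/-- Rename every register occurring in an IMP^W program along `m`. -/
def renameW (m : String → String) : ComW → ComW
  | .assign r a => .assign (m r) (renameAexp m a)
  | .seq p₁ p₂ => .seq (renameW m p₁) (renameW m p₂)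
  | .ifc r p₁ p₂ => .ifc (m r) (renameW m p₁) (renameW m p₂)
  | .whl r p => .whl (m r) (renameW m p)

theorem avalAtom_lt {A : Atom} {s : State} {b : ℕ} (hA : ∀ m ∈ constsAtom A, m < b)
    (hs : ∀ r, s r < b) : avalAtom A s < b := by
  cases A with
  | N n => exact hA n (by simp [constsAtom])
  | V r => exact hs r

theorem aval_lt_two_mul {a : Aexp} {s : State} {b : ℕ} (ha : ∀ m ∈ constsAexp a, m < b)
    (hs : ∀ r, s r < b) : aval a s < 2 * b := by
  cases a with
  | atom A =>
    have h := avalAtom_lt ha hs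
    simp only [aval]
    omega
  | add A₁ A₂ =>
    have h₁ := avalAtom_lt (fun m hm => ha m (List.mem_append_left _ hm)) hs
    have h₂ := avalAtom_lt (fun m hm => ha m (List.mem_append_right _ hm)) hs
    simp only [aval]
    omega
  | sub A₁ A₂ =>
    have h₁ := avalAtom_lt (fun m hm => ha m (List.mem_append_left _ hm)) hs
    simp only [aval]
    omega

/-- If every constant in the IMP^W program `p` and every register value of `s`
is below `2^w`, and `(p, s) ⇒ⁿ s'`, then every register value of `s'` is below
`2^(w+n)`. -/
theorem space_consumption_W (p : ComW) (s s' : State) (w n : ℕ)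
    (hp : ∀ m ∈ constsW p, m < 2 ^ w)
    (hs : ∀ r : String, s r < 2 ^ w)
    (hstep : BigStepW p s n s') :
    ∀ r : String, s' r < 2 ^ (w + n) := by
  have lt_pow_add {m v : ℕ} (k : ℕ) (h : m < 2 ^ v) : m < 2 ^ (v + k) :=
    h.trans_le (Nat.pow_le_pow_right two_pos (Nat.le_add_right v k))
  induction hstep generalizing w with
  | assign r a s =>
    intro r'
    unfold stUpd
    split_ifs
    · rw [pow_succ']
      exact aval_lt_two_mul hp hs
    · exact lt_pow_add 1 (hs r')
  | @seq p₁ p₂ s s' s'' n₁ n₂ _ _ ih₁ ih₂ =>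
    intro r
    have h₁ := ih₁ w (fun m hm => hp m (List.mem_append_left _ hm)) hs
    have h₂ := ih₂ (w + n₁)
      (fun m hm => lt_pow_add n₁ (hp m (List.mem_append_right _ hm))) h₁ r
    simpa only [add_assoc] using lt_pow_add 1 h₂
  | ifTrue _ _ ih =>
    exact fun r => lt_pow_add 1 (ih w (fun m hm => hp m (List.mem_append_left _ hm)) hs r)
  | ifFalse _ _ ih =>
    exact fun r => lt_pow_add 1 (ih w (fun m hm => hp m (List.mem_append_right _ hm)) hs r)
  | whileFalse _ => exact fun r => lt_pow_add 1 (hs r)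
  | @whileTrue _ p s s' s'' n₁ n₂ _ _ _ ih₁ ih₂ =>
    intro r
    have h₂ := ih₂ (w + n₁) (fun m hm => lt_pow_add n₁ (hp m hm)) (ih₁ w hp hs) r
    simpa only [add_assoc] using lt_pow_add 2 h₂
end

section
/- For every IMP^TC program p, context program tp, states s, s' and step count n: if (p, s) ⇒ⁿ (s', 0) in the flagged semantics, then tp ⊢ (p, s) ⇒ⁿ s' in the IMP^TC semantics. -/
set_option autoImplicit false

/-- If the flagged semantics runs `p` from `s` to `s'` in `n` steps with flag 0,
then `tp ⊢ (p, s) ⇒ⁿ s'` in the IMP^TC semantics (for any positive recursion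
cost constant `cR` and any context `tp`). -/
theorem flagged_zero_imp_tc (cR : ℕ) (hcR : 0 < cR) (tp p : ComTC)
    (s s' : State) (n : ℕ) (h : BigStepF p s n s' 0) :
    BigStepTC cR tp p s n s' := by
  generalize hb : 0 = b at h
  induction h with
  | assign r a s => exact .assign r a s
  | call hw => exact .call hw
  | recurse s => exact absurd hb Nat.zero_ne_one
  | seq _ _ ih₁ ih₂ => exact .seq (ih₁ rfl) (ih₂ hb)
  | ifTrue hr _ ih => exact .ifTrue hr (ih hb)
  | ifFalse hr _ ih => exact .ifFalse hr (ih hb)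
end

section
/- For every IMP^TC program p, context program tp, states s₁, s₂, s₃ and step counts n₁, n₂: if (p, s₁) ⇒^{n₁} (s₂, 1) in the flagged semantics and tp ⊢ (tp, s₂) ⇒^{n₂} s₃ in the IMP^TC semantics, then there exists n ≤ n₁ + n₂ + c_R with tp ⊢ (p, s₁) ⇒ⁿ s₃. -/
set_option autoImplicit false

/-- A flagged run ending with flag 0 is an IMP^TC run with the same step count,
in every context program. -/
theorem BigStepF.bigStepTC_of_flag_zero (cR : ℕ) (tp : ComTC) {p : ComTC} {s s' : State}
    {n b : ℕ} (h : BigStepF p s n s' b) (hb : b = 0) : BigStepTC cR tp p s n s' := by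
  induction h with
  | assign r a s => exact .assign r a s
  | call hc => exact .call hc
  | recurse s => exact absurd hb one_ne_zero
  | seq _ _ ih₁ ih₂ => exact .seq (ih₁ rfl) (ih₂ hb)
  | ifTrue hr _ ih => exact .ifTrue hr (ih hb)
  | ifFalse hr _ ih => exact .ifFalse hr (ih hb)

/-- If the flagged semantics runs `p` from `s₁` to `s₂` in `n₁` steps with flag 1,
and `tp ⊢ (tp, s₂) ⇒^{n₂} s₃`, then `tp ⊢ (p, s₁) ⇒ⁿ s₃` for some
`n ≤ n₁ + n₂ + cR`. -/
theorem flagged_one_imp_tc (cR : ℕ) (hcR : 0 < cR) (tp p : ComTC)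
    (s₁ s₂ s₃ : State) (n₁ n₂ : ℕ)
    (h₁ : BigStepF p s₁ n₁ s₂ 1) (h₂ : BigStepTC cR tp tp s₂ n₂ s₃) :
    ∃ n ≤ n₁ + n₂ + cR, BigStepTC cR tp p s₁ n s₃ := by
  generalize hb : (1 : ℕ) = b at h₁
  induction h₁ with
  | assign | call => exact absurd hb one_ne_zero
  | recurse => exact ⟨n₂ + cR, by omega, .recurse h₂⟩
  | seq hp₁ _ _ ih₂ =>
    obtain ⟨n, hn, h⟩ := ih₂ h₂ hb
    exact ⟨_, by omega, .seq (hp₁.bigStepTC_of_flag_zero cR tp rfl) h⟩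
  | ifTrue hr _ ih =>
    obtain ⟨n, hn, h⟩ := ih h₂ hb
    exact ⟨n + 1, by omega, .ifTrue hr h⟩
  | ifFalse hr _ ih =>
    obtain ⟨n, hn, h⟩ := ih h₂ hb
    exact ⟨n + 1, by omega, .ifFalse hr h⟩
end

section
/- There exists a constant c : ℕ such that for every IMP^W program p and every bit-width w, there is an IMP⁻ program q (the bit-blasting of p at width w) with the following property: whenever (p, s) ⇒ⁿ s' in IMP^W, n < w, s r · 2ⁿ < 2^w for every register r, and m · 2ⁿ < 2^w for every constant N m occurring in p, there exist n' ≤ c·(n+1)·(w+1) and an IMP⁻ state t such that (q, ⌊s⌋_w) ⇒^{n'} t and t agrees with ⌊s'⌋_w on every bit-register r'ᵢ (0 ≤ i ≤ w) of every non-reserved register r'. In particular, the step-count blow-up of bit-blasting is linear in n·w. -/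
set_option autoImplicit false

/-- An IMP⁻ state maps register names to bits. -/
abbrev BitState := String → Bool

/-- IMP⁻ commands: bit assignments, sequencing, if, while. -/
inductive ComM : Type where
  | assign : String → Bool → ComM
  | seq : ComM → ComM → ComM
  | ifc : String → ComM → ComM → ComM
  | whl : String → ComM → ComM

/-- Pointwise IMP⁻ state update. -/
def stUpdM (s : BitState) (r : String) (v : Bool) : BitState :=
  fun r' => if r = r' then v else s r'

/-- Big-step semantics of IMP⁻ with step counts. -/
inductive BigStepM : ComM → BitState → ℕ → BitState → Prop where
  | assign (r : String) (b : Bool) (s : BitState) :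
      BigStepM (.assign r b) s 1 (stUpdM s r b)
  | seq {p₁ p₂ : ComM} {s s' s'' : BitState} {n₁ n₂ : ℕ} :
      BigStepM p₁ s n₁ s' → BigStepM p₂ s' n₂ s'' →
      BigStepM (.seq p₁ p₂) s (n₁ + n₂ + 1) s''
  | ifTrue {r : String} {p₁ p₂ : ComM} {s s' : BitState} {n : ℕ} :
      s r = true → BigStepM p₁ s n s' → BigStepM (.ifc r p₁ p₂) s (n + 1) s'
  | ifFalse {r : String} {p₁ p₂ : ComM} {s s' : BitState} {n : ℕ} :
      s r = false → BigStepM p₂ s n s' → BigStepM (.ifc r p₁ p₂) s (n + 1) s'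
  | whileFalse {r : String} {p : ComM} {s : BitState} :
      s r = false → BigStepM (.whl r p) s 1 s
  | whileTrue {r : String} {p : ComM} {s s' s'' : BitState} {n₁ n₂ : ℕ} :
      s r = true → BigStepM p s n₁ s' → BigStepM (.whl r p) s' n₂ s'' →
      BigStepM (.whl r p) s (n₁ + n₂ + 2) s''

/-- `t` is the bit-blasted version ⌊s⌋_w of the IMP^W state `s` at width `w`,
relative to the bit-register naming scheme `enc`: the bit-register `enc r i`
(1 ≤ i ≤ w) holds the (i-1)-th binary digit of `s r`, and `enc r 0` holds 1
iff `s r mod 2^w ≠ 0`. -/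
def Represents (enc : String → ℕ → String) (w : ℕ) (s : State) (t : BitState) : Prop :=
  ∀ r : String,
    (∀ i : ℕ, 1 ≤ i → i ≤ w → t (enc r i) = (s r).testBit (i - 1)) ∧
    t (enc r 0) = decide (s r % 2 ^ w ≠ 0)

/-- `t` agrees with ⌊s⌋_w on every bit-register `enc r i` (0 ≤ i ≤ w) of every
register `r` not in the reserved set `RS`. -/
def AgreesOn (enc : String → ℕ → String) (w : ℕ) (RS : Finset String)
    (s : State) (t : BitState) : Prop :=
  ∀ r : String, r ∉ RS →
    (∀ i : ℕ, 1 ≤ i → i ≤ w → t (enc r i) = (s r).testBit (i - 1)) ∧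
    t (enc r 0) = decide (s r % 2 ^ w ≠ 0)

/-- Decision tree branching on the registers `f 0, …, f (w - 1)`, continuing with `k v`
in the leaf where these registers hold the binary digits of `v`. -/
def readNat : ℕ → (ℕ → String) → (ℕ → ComM) → ComM
  | 0, _, k => k 0
  | w + 1, f, k =>
      .ifc (f 0) (readNat w (fun i => f (i + 1)) fun v => k (Nat.bit true v))
        (readNat w (fun i => f (i + 1)) fun v => k (Nat.bit false v))

theorem bigStepM_readNat {w : ℕ} {f : ℕ → String} {k : ℕ → ComM} {v n : ℕ} {t t' : BitState}
    (hv : v < 2 ^ w) (hf : ∀ i < w, t (f i) = v.testBit i) (h : BigStepM (k v) t n t') :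
    BigStepM (readNat w f k) t (n + w) t' := by
  induction w generalizing f k v with
  | zero =>
    obtain rfl : v = 0 := by simpa using hv
    exact h
  | succ w ih =>
    have hb : Nat.bit (v.testBit 0) (v / 2) = v := by
      rw [Nat.testBit_zero, Nat.bit_val]
      rcases Nat.mod_two_eq_zero_or_one v with h' | h' <;> simp [h'] <;> omega
    have hdiv : v / 2 < 2 ^ w := by rw [pow_succ] at hv; omega
    have hdigits : ∀ i < w, t (f (i + 1)) = (v / 2).testBit i := fun i hi => by
      rw [hf (i + 1) (by omega), Nat.testBit_succ]
    have h0 := hf 0 (by omega)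
    rw [← hb] at h
    cases hc : v.testBit 0 <;> rw [hc] at h h0
    · exact .ifFalse h0 (ih (k := fun v => k (Nat.bit false v)) hdiv hdigits h)
    · exact .ifTrue h0 (ih (k := fun v => k (Nat.bit true v)) hdiv hdigits h)

/-- Assign the bits `b 0, …, b w` to the registers `f 0, …, f w`. -/
def writeBits (f : ℕ → String) (b : ℕ → Bool) : ℕ → ComM
  | 0 => .assign (f 0) (b 0)
  | w + 1 => .seq (writeBits f b w) (.assign (f (w + 1)) (b (w + 1)))

theorem bigStepM_writeBits {f : ℕ → String} (hf : Function.Injective f) (b : ℕ → Bool) (w : ℕ)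
    (t : BitState) :
    ∃ t', BigStepM (writeBits f b w) t (2 * w + 1) t' ∧ (∀ i ≤ w, t' (f i) = b i) ∧
      ∀ x, (∀ i, x ≠ f i) → t' x = t x := by
  induction w with
  | zero =>
    refine ⟨_, .assign _ _ _, ?_, fun x hx => if_neg (hx 0).symm⟩
    rintro i hi
    obtain rfl : i = 0 := by omega
    exact if_pos rfl
  | succ w ih =>
    obtain ⟨t', hrun, hin, hout⟩ := ih
    have hstep := hrun.seq (.assign (f (w + 1)) (b (w + 1)) t')
    rw [show 2 * w + 1 + 1 + 1 = 2 * (w + 1) + 1 by ring] at hstep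
    refine ⟨_, hstep, ?_, ?_⟩
    · intro i hi
      rcases eq_or_ne i (w + 1) with rfl | hne
      · exact if_pos rfl
      · exact (if_neg fun h => hne (hf h).symm).trans (hin i (by omega))
    · intro x hx
      exact (if_neg (hx (w + 1)).symm).trans (hout x hx)

/-- Content of the bit-register with index `i` of a register holding `v` at width `w`. -/
def blastedBit (w v : ℕ) : ℕ → Bool
  | 0 => decide (v % 2 ^ w ≠ 0)
  | i + 1 => v.testBit i

theorem represents_iff {enc : String → ℕ → String} {w : ℕ} {s : State} {t : BitState} :
    Represents enc w s t ↔ ∀ r, ∀ i ≤ w, t (enc r i) = blastedBit w (s r) i := by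
  refine forall_congr' fun r => ⟨fun ⟨h, h0⟩ i hi => ?_, fun h => ⟨fun i hi hiw => ?_, ?_⟩⟩
  · cases i with
    | zero => exact h0
    | succ i => exact h (i + 1) (by omega) hi
  · cases i with
    | zero => omega
    | succ i => exact h (i + 1) hiw
  · exact h 0 (Nat.zero_le w)

/-- Continue with `k v`, where `v` is the value of the given atom. -/
def readAtom (enc : String → ℕ → String) (w : ℕ) : Atom → (ℕ → ComM) → ComM
  | .N m, k => k m
  | .V r, k => readNat w (fun i => enc r (i + 1)) k

/-- Continue with `k v`, where `v` is the value of the given arithmetic expression. -/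
def readAexp (enc : String → ℕ → String) (w : ℕ) : Aexp → (ℕ → ComM) → ComM
  | .atom A, k => readAtom enc w A k
  | .add A₁ A₂, k => readAtom enc w A₁ fun x => readAtom enc w A₂ fun y => k (x + y)
  | .sub A₁ A₂, k => readAtom enc w A₁ fun x => readAtom enc w A₂ fun y => k (x - y)

/-- Bit-blasting of IMP^W programs at width `w`. -/
def bitblast (enc : String → ℕ → String) (w : ℕ) : ComW → ComM
  | .assign r a => readAexp enc w a fun v => writeBits (enc r) (blastedBit w v) w
  | .seq p₁ p₂ => .seq (bitblast enc w p₁) (bitblast enc w p₂)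
  | .ifc r p₁ p₂ => .ifc (enc r 0) (bitblast enc w p₁) (bitblast enc w p₂)
  | .whl r p => .whl (enc r 0) (bitblast enc w p)

section

variable {enc : String → ℕ → String} {w : ℕ} {s : State} {t : BitState}

theorem bigStepM_readAtom (ht : Represents enc w s t) (hs : ∀ r, s r < 2 ^ w) (A : Atom)
    {k : ℕ → ComM} {n : ℕ} {t' : BitState} (h : BigStepM (k (avalAtom A s)) t n t') :
    ∃ n' ≤ n + w, BigStepM (readAtom enc w A k) t n' t' := by
  cases A with
  | N m => exact ⟨n, by omega, h⟩
  | V r =>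
    exact ⟨n + w, le_rfl,
      bigStepM_readNat (hs r) (fun i hi => represents_iff.1 ht r (i + 1) hi) h⟩

theorem bigStepM_readAexp (ht : Represents enc w s t) (hs : ∀ r, s r < 2 ^ w) (a : Aexp)
    {k : ℕ → ComM} {n : ℕ} {t' : BitState} (h : BigStepM (k (aval a s)) t n t') :
    ∃ n' ≤ n + 2 * w, BigStepM (readAexp enc w a k) t n' t' := by
  cases a with
  | atom A =>
    obtain ⟨n₁, h₁, hrun⟩ := bigStepM_readAtom ht hs A h
    exact ⟨n₁, by omega, hrun⟩
  | add A₁ A₂ =>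
    obtain ⟨n₂, h₂, hrun₂⟩ := bigStepM_readAtom ht hs A₂ (k := fun y => k (avalAtom A₁ s + y)) h
    obtain ⟨n₁, h₁, hrun₁⟩ := bigStepM_readAtom ht hs A₁
      (k := fun x => readAtom enc w A₂ fun y => k (x + y)) hrun₂
    exact ⟨n₁, by omega, hrun₁⟩
  | sub A₁ A₂ =>
    obtain ⟨n₂, h₂, hrun₂⟩ := bigStepM_readAtom ht hs A₂ (k := fun y => k (avalAtom A₁ s - y)) h
    obtain ⟨n₁, h₁, hrun₁⟩ := bigStepM_readAtom ht hs A₁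
      (k := fun x => readAtom enc w A₂ fun y => k (x - y)) hrun₂
    exact ⟨n₁, by omega, hrun₁⟩

theorem bigStepM_bitblast_assign
    (henc : Function.Injective fun x : String × ℕ => enc x.1 x.2)
    (ht : Represents enc w s t) (hs : ∀ r, s r < 2 ^ w) (r : String) (a : Aexp) :
    ∃ n' ≤ 4 * (w + 1), ∃ t', BigStepM (bitblast enc w (.assign r a)) t n' t' ∧
      Represents enc w (stUpd s r (aval a s)) t' := by
  have hinj : Function.Injective (enc r) := fun i j h =>
    congrArg Prod.snd (henc (a₁ := (r, i)) (a₂ := (r, j)) h)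
  obtain ⟨t', hwrite, hin, hout⟩ := bigStepM_writeBits hinj (blastedBit w (aval a s)) w t
  obtain ⟨n', hn', hrun⟩ := bigStepM_readAexp ht hs a
    (k := fun v => writeBits (enc r) (blastedBit w v) w) hwrite
  refine ⟨n', by omega, t', hrun, represents_iff.2 fun r' i hi => ?_⟩
  by_cases hr : r = r'
  · subst hr
    simpa [stUpd] using hin i hi
  · rw [hout _ fun j h => hr (congrArg Prod.fst (henc (a₁ := (r', i)) (a₂ := (r, j)) h)).symm,
      represents_iff.1 ht r' i hi]
    simp [stUpd, hr]

theorem Represents.zero_bit_true (ht : Represents enc w s t) {r : String} (hs : s r < 2 ^ w)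
    (hr : s r ≠ 0) : t (enc r 0) = true := by
  simpa [(ht r).2, Nat.mod_eq_of_lt hs] using hr

theorem Represents.zero_bit_false (ht : Represents enc w s t) {r : String}
    (hr : s r = 0) : t (enc r 0) = false := by
  simp [(ht r).2, hr]

end

theorem avalAtom_mul_lt {s : State} {A : Atom} {b B : ℕ} (hs : ∀ r, s r * b < B)
    (hc : ∀ m ∈ constsAtom A, m * b < B) : avalAtom A s * b < B := by
  cases A with
  | N m => exact hc m (by simp [constsAtom])
  | V r => exact hs r

theorem aval_mul_lt {s : State} {a : Aexp} {b B : ℕ} (hs : ∀ r, s r * (2 * b) < B)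
    (hc : ∀ m ∈ constsAexp a, m * (2 * b) < B) : aval a s * b < B := by
  cases a with
  | atom A =>
    have := avalAtom_mul_lt (A := A) hs hc
    simp only [aval]
    nlinarith
  | add A₁ A₂ =>
    have h₁ := avalAtom_mul_lt (A := A₁) hs fun m hm => hc m (by simp [constsAexp, hm])
    have h₂ := avalAtom_mul_lt (A := A₂) hs fun m hm => hc m (by simp [constsAexp, hm])
    simp only [aval]
    nlinarith
  | sub A₁ A₂ =>
    have h₁ := avalAtom_mul_lt (A := A₁) hs fun m hm => hc m (by simp [constsAexp, hm])
    have h₂ := Nat.mul_le_mul_right b (Nat.sub_le (avalAtom A₁ s) (avalAtom A₂ s))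
    simp only [aval]
    nlinarith

theorem mul_two_pow_lt_of_le {m i j B : ℕ} (hij : i ≤ j) (h : m * 2 ^ j < B) : m * 2 ^ i < B :=
  (Nat.mul_le_mul_left m (Nat.pow_le_pow_right two_pos hij)).trans_lt h

theorem lt_of_mul_two_pow_lt {m j B : ℕ} (h : m * 2 ^ j < B) : m < B := by
  simpa using mul_two_pow_lt_of_le (Nat.zero_le j) h

/-- In each step the values of the registers at most double. -/
theorem BigStepW.mul_two_pow_lt {p : ComW} {s s' : State} {n B : ℕ} (h : BigStepW p s n s')
    (k : ℕ) (hs : ∀ r, s r * 2 ^ (n + k) < B) (hc : ∀ m ∈ constsW p, m * 2 ^ (n + k) < B) :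
    ∀ r, s' r * 2 ^ k < B := by
  induction h generalizing k with
  | assign r a s =>
    intro r'
    by_cases hr : r = r'
    · have h2 : 2 ^ (1 + k) = 2 * 2 ^ k := by rw [pow_add, pow_one]
      rw [h2] at hs hc
      simpa [stUpd, hr] using aval_mul_lt hs hc
    · simpa [stUpd, hr] using mul_two_pow_lt_of_le (by omega) (hs r')
  | @seq p₁ p₂ s s' s'' n₁ n₂ _ _ ih₁ ih₂ =>
    refine ih₂ k (ih₁ (n₂ + k) (fun r => ?_) fun m hm => ?_) fun m hm => ?_
    · exact mul_two_pow_lt_of_le (by omega) (hs r)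
    · exact mul_two_pow_lt_of_le (by omega) (hc m (by simp [constsW, hm]))
    · exact mul_two_pow_lt_of_le (by omega) (hc m (by simp [constsW, hm]))
  | ifTrue _ _ ih =>
    exact ih k (fun r => mul_two_pow_lt_of_le (by omega) (hs r))
      fun m hm => mul_two_pow_lt_of_le (by omega) (hc m (by simp [constsW, hm]))
  | ifFalse _ _ ih =>
    exact ih k (fun r => mul_two_pow_lt_of_le (by omega) (hs r))
      fun m hm => mul_two_pow_lt_of_le (by omega) (hc m (by simp [constsW, hm]))
  | whileFalse _ => exact fun r => mul_two_pow_lt_of_le (by omega) (hs r)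
  | @whileTrue r p s s' s'' n₁ n₂ _ _ _ ih₁ ih₂ =>
    refine ih₂ k (ih₁ (n₂ + k) (fun r => ?_) fun m hm => ?_) fun m hm => ?_
    · exact mul_two_pow_lt_of_le (by omega) (hs r)
    · exact mul_two_pow_lt_of_le (by omega) (hc m hm)
    · exact mul_two_pow_lt_of_le (by omega) (hc m hm)

theorem BigStepW.bitblast {enc : String → ℕ → String}
    (henc : Function.Injective fun x : String × ℕ => enc x.1 x.2) {w : ℕ}
    {p : ComW} {s s' : State} {n : ℕ} (h : BigStepW p s n s')
    (hs : ∀ r, s r * 2 ^ n < 2 ^ w) (hc : ∀ m ∈ constsW p, m * 2 ^ n < 2 ^ w)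
    {t : BitState} (ht : Represents enc w s t) :
    ∃ n' ≤ 4 * n * (w + 1), ∃ t', BigStepM (bitblast enc w p) t n' t' ∧
      Represents enc w s' t' := by
  induction h generalizing t with
  | assign r a s =>
    simpa using bigStepM_bitblast_assign henc ht (fun r' => lt_of_mul_two_pow_lt (hs r')) r a
  | @seq p₁ p₂ s s' s'' n₁ n₂ h₁ _ ih₁ ih₂ =>
    have hc₁ : ∀ m ∈ constsW p₁, m * 2 ^ (n₁ + n₂) < 2 ^ w := fun m hm =>
      mul_two_pow_lt_of_le (by omega) (hc m (by simp [constsW, hm]))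
    obtain ⟨k₁, hk₁, t₁, hrun₁, ht₁⟩ := ih₁
      (fun r => mul_two_pow_lt_of_le (by omega) (hs r))
      (fun m hm => mul_two_pow_lt_of_le (by omega) (hc₁ m hm)) ht
    obtain ⟨k₂, hk₂, t₂, hrun₂, ht₂⟩ := ih₂
      (h₁.mul_two_pow_lt n₂ (fun r => mul_two_pow_lt_of_le (by omega) (hs r)) hc₁)
      (fun m hm => mul_two_pow_lt_of_le (by omega) (hc m (by simp [constsW, hm]))) ht₁
    exact ⟨_, by nlinarith, t₂, .seq hrun₁ hrun₂, ht₂⟩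
  | ifTrue hr _ ih =>
    obtain ⟨k, hk, t', hrun, ht'⟩ := ih
      (fun r => mul_two_pow_lt_of_le (by omega) (hs r))
      (fun m hm => mul_two_pow_lt_of_le (by omega) (hc m (by simp [constsW, hm]))) ht
    exact ⟨_, by nlinarith, t',
      .ifTrue (ht.zero_bit_true (lt_of_mul_two_pow_lt (hs _)) hr) hrun, ht'⟩
  | ifFalse hr _ ih =>
    obtain ⟨k, hk, t', hrun, ht'⟩ := ih
      (fun r => mul_two_pow_lt_of_le (by omega) (hs r))
      (fun m hm => mul_two_pow_lt_of_le (by omega) (hc m (by simp [constsW, hm]))) ht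
    exact ⟨_, by nlinarith, t', .ifFalse (ht.zero_bit_false hr) hrun, ht'⟩
  | whileFalse hr =>
    exact ⟨1, by omega, t, .whileFalse (ht.zero_bit_false hr), ht⟩
  | @whileTrue r p s s' s'' n₁ n₂ hr h₁ _ ih₁ ih₂ =>
    obtain ⟨k₁, hk₁, t₁, hrun₁, ht₁⟩ := ih₁
      (fun r => mul_two_pow_lt_of_le (by omega) (hs r))
      (fun m hm => mul_two_pow_lt_of_le (by omega) (hc m hm)) ht
    obtain ⟨k₂, hk₂, t₂, hrun₂, ht₂⟩ := ih₂
      (h₁.mul_two_pow_lt n₂ (fun r => mul_two_pow_lt_of_le (by omega) (hs r))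
        (fun m hm => mul_two_pow_lt_of_le (by omega) (hc m hm)))
      (fun m hm => mul_two_pow_lt_of_le (by omega) (hc m hm)) ht₁
    exact ⟨_, by nlinarith, t₂,
      .whileTrue (ht.zero_bit_true (lt_of_mul_two_pow_lt (hs r)) hr) hrun₁ hrun₂, ht₂⟩

/-- Bit-blasting of IMP^W programs: there is a constant `c` such that, for every
injective bit-register naming scheme `enc`, there are finitely many reserved
auxiliary registers `RS` such that every IMP^W program `p` and width `w` admit an
IMP⁻ program `q` with: whenever `(p, s) ⇒ⁿ s'`, `n < w`, `s r · 2ⁿ < 2^w` for all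
registers `r`, and `m · 2ⁿ < 2^w` for all constants `m` of `p`, then `q` run from
`⌊s⌋_w` terminates in at most `c·(n+1)·(w+1)` steps in a state agreeing with
`⌊s'⌋_w` on all bit-registers of non-reserved registers. -/
theorem bitblast_program_correct :
    ∃ c : ℕ, ∀ enc : String → ℕ → String,
      Function.Injective (fun x : String × ℕ => enc x.1 x.2) →
      ∃ RS : Finset String,
        ∀ (p : ComW) (w : ℕ),
          ∃ q : ComM, ∀ (s s' : State) (n : ℕ),
            BigStepW p s n s' → n < w →
            (∀ r : String, s r * 2 ^ n < 2 ^ w) →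
            (∀ m ∈ constsW p, m * 2 ^ n < 2 ^ w) →
            ∀ t₀ : BitState, Represents enc w s t₀ →
              ∃ (n' : ℕ) (t : BitState), n' ≤ c * (n + 1) * (w + 1) ∧
                BigStepM q t₀ n' t ∧
                AgreesOn enc w RS s' t := by
  refine ⟨4, fun enc henc => ⟨∅, fun p w =>
    ⟨bitblast enc w p, fun s s' n h _ hs hc t₀ ht₀ => ?_⟩⟩⟩
  obtain ⟨n', hn', t, hrun, ht⟩ := h.bitblast henc hs hc ht₀
  exact ⟨n', t, hn'.trans (by gcongr; omega), hrun, fun r _ => ht r⟩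
end
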